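/- arXiv:2507.16105 — 4 statements merged into one kernel-verified Lean document; each statement's English description precedes it below -/
import Mathlib

section
/- Let b : L ⊕ R → Fin ℓ be a labelling and let M' be a family of ℓ-matchings in K_{n,n}, each consistent with b, with |M'| ≥ 2. Let K = ⋂_{M ∈ M'} V(M), and let D be the set of edges (u,v) ∈ L × R with u ∈ K, v ∈ K and b(u) = b(v). Suppose that for x sampled uniformly among subsets of L ⊕ R, the probability that there exists M ∈ M' with V(M) \ K ⊆ x is at least 1 − δ. Then, for c sampled uniformly among all colourings c : L ⊕ R → {0,1}, the probability that there exists M ∈ M' such that every edge of M \ D is monochromatic under c is at least 1 − δ. -/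
/-- A matching in `K_{n,n}`: a set of edges with pairwise distinct left endpoints
and pairwise distinct right endpoints. -/
def IsMatching {n : ℕ} (M : Finset (Fin n × Fin n)) : Prop :=
  ∀ e ∈ M, ∀ e' ∈ M, e ≠ e' → e.1 ≠ e'.1 ∧ e.2 ≠ e'.2

/-- A matching `M` is consistent with a labelling `b : L ⊕ R → Fin ℓ` if every edge of `M` is
monochromatic under `b` and distinct edges of `M` receive distinct labels. -/
def ConsistentWith {n ℓ : ℕ} (M : Finset (Fin n × Fin n)) (b : Fin n ⊕ Fin n → Fin ℓ) : Prop :=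
  (∀ e ∈ M, b (Sum.inl e.1) = b (Sum.inr e.2)) ∧
  (∀ e ∈ M, ∀ e' ∈ M, e ≠ e' → b (Sum.inl e.1) ≠ b (Sum.inl e'.1))

/-- `V(M)`: the set of endpoints (in `L ⊕ R`) of the edges of `M`. -/
def endpoints {n : ℕ} (M : Finset (Fin n × Fin n)) : Finset (Fin n ⊕ Fin n) :=
  M.image (fun e => Sum.inl e.1) ∪ M.image (fun e => Sum.inr e.2)

open Classical in
/-- The colouring attached to a subset `x`: a vertex is coloured by membership in `x`, except that
a vertex outside `K` sharing its label with some vertex of `K` is coloured by whether its membership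
in `x` agrees with that of a chosen such vertex. -/
noncomputable def pivotColouring {V ι : Type*} (b : V → ι) (K x : Finset V) (w : V) : Bool :=
  if h : w ∉ K ∧ ∃ k ∈ K, b k = b w then decide (w ∈ x) == decide (h.2.choose ∈ x)
  else decide (w ∈ x)

theorem pivotColouring_of_mem {V ι : Type*} (b : V → ι) {K : Finset V} (x : Finset V) {w : V}
    (hw : w ∈ K) : pivotColouring b K x w = true ↔ w ∈ x := by
  simp [pivotColouring, hw]

theorem pivotColouring_of_forall_ne {V ι : Type*} (b : V → ι) {K : Finset V} (x : Finset V) {w : V}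
    (hw : ∀ k ∈ K, b k ≠ b w) : pivotColouring b K x w = true ↔ w ∈ x := by
  have h : ¬(w ∉ K ∧ ∃ k ∈ K, b k = b w) := fun h => by
    obtain ⟨k, hk, hkw⟩ := h.2
    exact hw k hk hkw
  simp only [pivotColouring, dif_neg h, decide_eq_true_eq]

theorem exists_pivotColouring_iff {V ι : Type*} (b : V → ι) {K : Finset V} {w : V}
    (hw : w ∉ K) (h : ∃ k ∈ K, b k = b w) :
    ∃ k ∈ K, b k = b w ∧
      ∀ x : Finset V, pivotColouring b K x w = true ↔ (w ∈ x ↔ k ∈ x) := by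
  refine ⟨h.choose, h.choose_spec.1, h.choose_spec.2, fun x => ?_⟩
  rw [pivotColouring, dif_pos ⟨hw, h⟩]
  simp

theorem pivotColouring_injective {V ι : Type*} (b : V → ι) (K : Finset V) :
    Function.Injective (pivotColouring b K) := by
  intro x y hxy
  have hiff (w : V) : pivotColouring b K x w = true ↔ pivotColouring b K y w = true := by
    rw [hxy]
  have hmem (w : V) (hw : w ∈ K) : w ∈ x ↔ w ∈ y := by
    rw [← pivotColouring_of_mem b x hw, ← pivotColouring_of_mem b y hw, hiff]
  ext w
  by_cases hw : w ∈ K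
  · exact hmem w hw
  by_cases h : ∃ k ∈ K, b k = b w
  · obtain ⟨k, hk, -, hc⟩ := exists_pivotColouring_iff b hw h
    have hwk := hiff w
    rw [hc, hc] at hwk
    have := hmem k hk
    tauto
  · push Not at h
    rw [← pivotColouring_of_forall_ne b x h, ← pivotColouring_of_forall_ne b y h, hiff]

theorem inl_mem_endpoints {n : ℕ} {M : Finset (Fin n × Fin n)} {e : Fin n × Fin n} (he : e ∈ M) :
    Sum.inl e.1 ∈ endpoints M :=
  Finset.mem_union_left _ (Finset.mem_image_of_mem (fun e => Sum.inl e.1) he)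

theorem inr_mem_endpoints {n : ℕ} {M : Finset (Fin n × Fin n)} {e : Fin n × Fin n} (he : e ∈ M) :
    Sum.inr e.2 ∈ endpoints M :=
  Finset.mem_union_right _ (Finset.mem_image_of_mem (fun e => Sum.inr e.2) he)

/-- In a consistent matching, the label of an edge determines its endpoints. -/
theorem ConsistentWith.eq_or_eq_of_label_eq {n ℓ : ℕ} {M : Finset (Fin n × Fin n)}
    {b : Fin n ⊕ Fin n → Fin ℓ} (hM : ConsistentWith M b) {e : Fin n × Fin n} (he : e ∈ M)
    {k : Fin n ⊕ Fin n} (hk : k ∈ endpoints M) (hb : b k = b (Sum.inl e.1)) :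
    k = Sum.inl e.1 ∨ k = Sum.inr e.2 := by
  simp only [endpoints, Finset.mem_union, Finset.mem_image] at hk
  rcases hk with ⟨f, hf, rfl⟩ | ⟨f, hf, rfl⟩
  · by_cases hfe : f = e
    · simp [hfe]
    · exact absurd hb (hM.2 f hf e he hfe)
  · by_cases hfe : f = e
    · simp [hfe]
    · exact absurd ((hM.1 f hf).trans hb) (hM.2 f hf e he hfe)

/-- An edge of a consistent matching `M` not contained in the kernel `K` is monochromatic under the
colouring attached to any set `x` containing `V(M) \ K`. -/
theorem ConsistentWith.pivotColouring_eq {n ℓ : ℕ} {M : Finset (Fin n × Fin n)}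
    {b : Fin n ⊕ Fin n → Fin ℓ} (hM : ConsistentWith M b) {K x : Finset (Fin n ⊕ Fin n)}
    (hK : K ⊆ endpoints M) (hx : endpoints M \ K ⊆ x) {e : Fin n × Fin n} (he : e ∈ M)
    (heK : ¬(Sum.inl e.1 ∈ K ∧ Sum.inr e.2 ∈ K)) :
    pivotColouring b K x (Sum.inl e.1) = pivotColouring b K x (Sum.inr e.2) := by
  have hbe := hM.1 e he
  have hend : ∀ k ∈ K, b k = b (Sum.inl e.1) → k = Sum.inl e.1 ∨ k = Sum.inr e.2 :=
    fun k hk => hM.eq_or_eq_of_label_eq he (hK hk)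
  have hxl (h : Sum.inl e.1 ∉ K) : Sum.inl e.1 ∈ x :=
    hx (Finset.mem_sdiff.2 ⟨inl_mem_endpoints he, h⟩)
  have hxr (h : Sum.inr e.2 ∉ K) : Sum.inr e.2 ∈ x :=
    hx (Finset.mem_sdiff.2 ⟨inr_mem_endpoints he, h⟩)
  rw [Bool.eq_iff_iff]
  by_cases hl : Sum.inl e.1 ∈ K
  · have hr : Sum.inr e.2 ∉ K := fun hr => heK ⟨hl, hr⟩
    obtain ⟨k, hk, hkb, hc⟩ := exists_pivotColouring_iff b hr ⟨_, hl, hbe⟩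
    obtain rfl : k = Sum.inl e.1 :=
      (hend k hk (hkb.trans hbe.symm)).resolve_right fun h => hr (h ▸ hk)
    rw [pivotColouring_of_mem b x hl, hc]
    simp [hxr hr]
  by_cases hr : Sum.inr e.2 ∈ K
  · obtain ⟨k, hk, hkb, hc⟩ := exists_pivotColouring_iff b hl ⟨_, hr, hbe.symm⟩
    obtain rfl : k = Sum.inr e.2 := (hend k hk hkb).resolve_left fun h => hl (h ▸ hk)
    rw [pivotColouring_of_mem b x hr, hc]
    simp [hxl hl]
  · have hne : ∀ k ∈ K, b k ≠ b (Sum.inl e.1) := fun k hk hkb => by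
      rcases hend k hk hkb with rfl | rfl
      exacts [hl hk, hr hk]
    rw [pivotColouring_of_forall_ne b x hne, pivotColouring_of_forall_ne b x (hbe ▸ hne)]
    simp [hxl hl, hxr hr]

/-- Let `𝓜'` be a family of `ℓ`-matchings, each consistent with `b`, with `|𝓜'| ≥ 2`, let
`K = ⋂_{M ∈ 𝓜'} V(M)`, and let `D` be the set of edges with both endpoints in `K` sharing the
same label. If, over a uniform subset `x` of `L ⊕ R`, the probability that some `M ∈ 𝓜'` has
`V(M) \ K ⊆ x` is at least `1 - δ`, then over a uniform colouring `c : L ⊕ R → {0,1}`, the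
probability that some `M ∈ 𝓜'` has every edge of `M \ D` monochromatic is at least `1 - δ`. -/
theorem sunflower_error_transfer (n ℓ : ℕ) (δ : ℝ) (b : Fin n ⊕ Fin n → Fin ℓ)
    (𝓜' : Finset (Finset (Fin n × Fin n)))
    (h𝓜' : ∀ M ∈ 𝓜', IsMatching M ∧ M.card = ℓ ∧ ConsistentWith M b)
    (hcard : 2 ≤ 𝓜'.card)
    (K : Finset (Fin n ⊕ Fin n)) (hK : K = 𝓜'.inf endpoints)
    (D : Finset (Fin n × Fin n))
    (hD : D = Finset.univ.filter (fun e : Fin n × Fin n =>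
      Sum.inl e.1 ∈ K ∧ Sum.inr e.2 ∈ K ∧ b (Sum.inl e.1) = b (Sum.inr e.2)))
    (hprob : 1 - δ ≤
      (Nat.card {x : Finset (Fin n ⊕ Fin n) //
          ∃ M ∈ 𝓜', endpoints M \ K ⊆ x} : ℝ) / (2 : ℝ) ^ (2 * n)) :
    1 - δ ≤
      (Nat.card {c : Fin n ⊕ Fin n → Bool //
          ∃ M ∈ 𝓜', ∀ e ∈ M \ D, c (Sum.inl e.1) = c (Sum.inr e.2)} : ℝ) /
        (2 : ℝ) ^ (2 * n) := by
  refine hprob.trans ?_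
  gcongr
  refine Nat.card_le_card_of_injective
    (Subtype.map (pivotColouring b K) ?_) (Subtype.map_injective _ (pivotColouring_injective b K))
  rintro x ⟨M, hM, hx⟩
  refine ⟨M, hM, fun e he => ?_⟩
  obtain ⟨heM, heD⟩ := Finset.mem_sdiff.1 he
  have hcons := (h𝓜' M hM).2.2
  refine hcons.pivotColouring_eq (hK ▸ Finset.inf_le hM) hx heM fun h => heD ?_
  rw [hD]
  exact Finset.mem_filter.2 ⟨Finset.mem_univ _, h.1, h.2, hcons.1 e heM⟩
end

section
/- Let n ≥ 1, let r ≥ 0 be a real number, and let M be a finite family of nonempty matchings in K_{n,n} such that for every ℓ ≥ 1 the number of ℓ-matchings in M is at most r^ℓ. Then (1/2)·Pr_{c}[F_M(x(c)) = 0] + (1/2)·Pr_{P}[F_M(P) = 1] ≤ 1/2 + Σ_{ℓ=1}^{n} (e·r/n)^ℓ, where c is sampled uniformly among colourings of L ⊕ R with an odd number of vertices coloured 1, and P is sampled uniformly among perfect matchings of K_{n,n} (viewed as graphs). -/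
/-- A colouring of the vertices `L ⊕ R` of `K_{n,n}` with an odd number of `1`s. -/
def OddColouring {n : ℕ} (c : Fin n ⊕ Fin n → Bool) : Prop :=
  Odd (Nat.card {v : Fin n ⊕ Fin n // c v = true})
/-- `x(c)`: the bipartite graph consisting of all edges monochromatic under the colouring `c`. -/
def graphOf {n : ℕ} (c : Fin n ⊕ Fin n → Bool) : Finset (Fin n × Fin n) :=
  Finset.univ.filter (fun e : Fin n × Fin n => c (Sum.inl e.1) = c (Sum.inr e.2))

/-- The perfect matching of `K_{n,n}` given by the graph of a permutation. -/
def permMatching {n : ℕ} (σ : Equiv.Perm (Fin n)) : Finset (Fin n × Fin n) :=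
  Finset.univ.filter (fun e => σ e.1 = e.2)

theorem mem_permMatching {n : ℕ} {σ : Equiv.Perm (Fin n)} {e : Fin n × Fin n} :
    e ∈ permMatching σ ↔ σ e.1 = e.2 := by
  simp [permMatching]

theorem permMatching_injective {n : ℕ} :
    Function.Injective (permMatching : Equiv.Perm (Fin n) → Finset (Fin n × Fin n)) := by
  intro σ τ h
  refine Equiv.ext fun i => ?_
  have hi : (i, σ i) ∈ permMatching τ := h ▸ mem_permMatching.2 rfl
  exact (mem_permMatching.1 hi).symm

theorem IsMatching.injOn_fst {n : ℕ} {M : Finset (Fin n × Fin n)} (hM : IsMatching M) :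
    Set.InjOn Prod.fst (M : Set (Fin n × Fin n)) := by
  intro e he e' he' h
  by_contra hne
  exact (hM e he e' he' hne).1 h

theorem IsMatching.card_le {n : ℕ} {M : Finset (Fin n × Fin n)} (hM : IsMatching M) :
    M.card ≤ n := by
  rw [← Finset.card_image_of_injOn hM.injOn_fst]
  simpa using Finset.card_le_univ (M.image Prod.fst)

theorem isMatching_permMatching {n : ℕ} (σ : Equiv.Perm (Fin n)) :
    IsMatching (permMatching σ) := by
  intro e he e' he' hne
  rw [mem_permMatching] at he he'
  refine ⟨fun h => hne (Prod.ext h ?_), fun h => hne (Prod.ext ?_ h)⟩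
  · rw [← he, ← he', h]
  · exact σ.injective (by rw [he, he', h])

theorem card_permMatching {n : ℕ} (σ : Equiv.Perm (Fin n)) : (permMatching σ).card = n := by
  have h : permMatching σ = Finset.univ.image (fun i => (i, σ i)) := by
    ext ⟨i, j⟩
    simp [mem_permMatching]
  rw [h, Finset.card_image_of_injective _ (fun i j hij => (Prod.ext_iff.1 hij).1)]
  simp

theorem IsMatching.exists_permMatching_eq {n : ℕ} {P : Finset (Fin n × Fin n)}
    (hP : IsMatching P) (hcard : P.card = n) : ∃ σ, permMatching σ = P := by
  have himage : P.image Prod.fst = Finset.univ := by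
    rw [← Finset.card_eq_iff_eq_univ, Finset.card_image_of_injOn hP.injOn_fst, hcard,
      Fintype.card_fin]
  have hex : ∀ i, ∃ j, (i, j) ∈ P := by
    intro i
    have hi : i ∈ P.image Prod.fst := himage ▸ Finset.mem_univ i
    obtain ⟨⟨a, b⟩, hab, rfl⟩ := Finset.mem_image.1 hi
    exact ⟨b, hab⟩
  choose f hf using hex
  have hinj : Function.Injective f := by
    intro i j hij
    by_contra hne
    exact (hP _ (hf i) _ (hf j) (fun h => hne (Prod.ext_iff.1 h).1)).2 hij
  refine ⟨Equiv.ofBijective f (Finite.injective_iff_bijective.1 hinj), ?_⟩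
  ext ⟨i, j⟩
  rw [mem_permMatching]
  constructor
  · intro hij
    have hij' : f i = j := hij
    exact hij' ▸ hf i
  · intro hij
    exact (Prod.ext_iff.1 (hP.injOn_fst (hf i) hij rfl)).2

/-- Counting perfect matchings with a property amounts to counting permutations. -/
theorem card_perfectMatching_and {n : ℕ} (Q : Finset (Fin n × Fin n) → Prop) :
    Nat.card {P : Finset (Fin n × Fin n) // (IsMatching P ∧ P.card = n) ∧ Q P} =
      Nat.card {σ : Equiv.Perm (Fin n) // Q (permMatching σ)} := by
  symm
  refine Nat.card_eq_of_bijective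
    (fun σ => ⟨permMatching σ.1, ⟨isMatching_permMatching _, card_permMatching _⟩, σ.2⟩)
    ⟨fun σ τ h => Subtype.ext (permMatching_injective (Subtype.ext_iff.1 h)), ?_⟩
  rintro ⟨P, ⟨hP, hcard⟩, hQ⟩
  obtain ⟨σ, rfl⟩ := hP.exists_permMatching_eq hcard
  exact ⟨⟨σ, hQ⟩, rfl⟩

theorem card_perfectMatching (n : ℕ) :
    Nat.card {P : Finset (Fin n × Fin n) // IsMatching P ∧ P.card = n} = n.factorial := by
  have h := card_perfectMatching_and (n := n) (fun _ => True)
  simp only [and_true] at h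
  rw [h, Nat.card_congr (Equiv.subtypeUnivEquiv fun _ => trivial), Nat.card_perm, Nat.card_fin]

/-- At most `(n - |M|)!` permutations extend the matching `M`. -/
theorem IsMatching.card_perm_extending_le {n : ℕ} {M : Finset (Fin n × Fin n)}
    (hM : IsMatching M) :
    (Finset.univ.filter (fun σ : Equiv.Perm (Fin n) => M ⊆ permMatching σ)).card ≤
      (n - M.card).factorial := by
  rcases (Finset.univ.filter
    (fun σ : Equiv.Perm (Fin n) => M ⊆ permMatching σ)).eq_empty_or_nonempty with h | ⟨τ, hτ⟩
  · simp [h]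
  · replace hτ := (Finset.mem_filter.1 hτ).2
    have hfix : Fintype.card {σ : Equiv.Perm (Fin n) // ∀ i, ¬ i ∉ M.image Prod.fst → σ i = i} =
        (n - M.card).factorial := by
      rw [← Fintype.card_congr
        (Equiv.Perm.subtypeEquivSubtypePerm (fun i => i ∉ M.image Prod.fst)),
        Fintype.card_perm, Fintype.card_subtype_compl, Fintype.card_coe,
        Finset.card_image_of_injOn hM.injOn_fst, Fintype.card_fin]
    rw [← hfix, Fintype.card_subtype]
    refine Finset.card_le_card_of_injOn (fun σ => τ⁻¹ * σ) ?_ (mul_right_injective _).injOn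
    intro σ hσ
    replace hσ := (Finset.mem_filter.1 hσ).2
    refine Finset.mem_filter.2 ⟨Finset.mem_univ _, fun i hi => ?_⟩
    obtain ⟨e, he, rfl⟩ := Finset.mem_image.1 (not_not.1 hi)
    rw [Equiv.Perm.mul_apply, mem_permMatching.1 (hσ he), Equiv.Perm.inv_eq_iff_eq]
    exact (mem_permMatching.1 (hτ he)).symm

theorem pow_mul_factorial_le_pow_mul_descFactorial {n l : ℕ} (h : l ≤ n) :
    n ^ l * l.factorial ≤ l ^ l * n.descFactorial l := by
  rw [← Nat.descFactorial_self l, Nat.descFactorial_eq_prod_range,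
    Nat.descFactorial_eq_prod_range]
  have hpow : ∀ a : ℕ, a ^ l = ∏ _i ∈ Finset.range l, a := by simp
  rw [hpow n, hpow l, ← Finset.prod_mul_distrib, ← Finset.prod_mul_distrib]
  refine Finset.prod_le_prod' fun i _ => ?_
  rw [Nat.mul_sub, Nat.mul_sub, Nat.mul_comm l n]
  exact Nat.sub_le_sub_left (Nat.mul_le_mul_right i h) _

theorem factorial_sub_div_factorial_le {n l : ℕ} (hn : 1 ≤ n) (h : l ≤ n) :
    ((n - l).factorial : ℝ) / n.factorial ≤ (Real.exp 1 / n) ^ l := by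
  have hn0 : (0 : ℝ) < n := by exact_mod_cast hn
  have hexp : (l : ℝ) ^ l ≤ Real.exp 1 ^ l * l.factorial := by
    have := Real.pow_div_factorial_le_exp (l : ℝ) (Nat.cast_nonneg l) l
    rwa [div_le_iff₀ (by positivity), ← mul_one (l : ℝ), Real.exp_nat_mul, mul_one] at this
  have hdesc : (n : ℝ) ^ l ≤ Real.exp 1 ^ l * n.descFactorial l := by
    have hnat : (n : ℝ) ^ l * l.factorial ≤ (l : ℝ) ^ l * n.descFactorial l := by
      exact_mod_cast pow_mul_factorial_le_pow_mul_descFactorial h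
    refine le_of_mul_le_mul_right (hnat.trans ?_) (by positivity : (0 : ℝ) < l.factorial)
    calc (l : ℝ) ^ l * n.descFactorial l
        ≤ (Real.exp 1 ^ l * l.factorial) * n.descFactorial l := by gcongr
      _ = Real.exp 1 ^ l * n.descFactorial l * l.factorial := by ring
  have hfac : (n.factorial : ℝ) = (n - l).factorial * n.descFactorial l := by
    exact_mod_cast (Nat.factorial_mul_descFactorial h).symm
  rw [div_pow, div_le_div_iff₀ (by positivity) (by positivity), hfac]
  calc ((n - l).factorial : ℝ) * (n : ℝ) ^ l
      ≤ (n - l).factorial * (Real.exp 1 ^ l * n.descFactorial l) := by gcongr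
    _ = Real.exp 1 ^ l * ((n - l).factorial * n.descFactorial l) := by ring

theorem card_perfectMatching_accepted_le {n : ℕ} (𝓜 : Finset (Finset (Fin n × Fin n)))
    (h𝓜 : ∀ M ∈ 𝓜, IsMatching M ∧ M.Nonempty) :
    Nat.card {P : Finset (Fin n × Fin n) // (IsMatching P ∧ P.card = n) ∧ ∃ M ∈ 𝓜, M ⊆ P} ≤
      ∑ l ∈ Finset.Icc 1 n, (𝓜.filter (fun M => M.card = l)).card * (n - l).factorial := by
  rw [card_perfectMatching_and (fun P => ∃ M ∈ 𝓜, M ⊆ P), Nat.card_eq_fintype_card,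
    Fintype.card_subtype]
  have hunion : Finset.univ.filter
      (fun σ : Equiv.Perm (Fin n) => ∃ M ∈ 𝓜, M ⊆ permMatching σ) =
      𝓜.biUnion (fun M => Finset.univ.filter (fun σ => M ⊆ permMatching σ)) := by
    ext σ
    simp
  have hmaps : ∀ M ∈ 𝓜, M.card ∈ Finset.Icc 1 n := fun M hM =>
    Finset.mem_Icc.2 ⟨(h𝓜 M hM).2.card_pos, (h𝓜 M hM).1.card_le⟩
  rw [hunion]
  refine Finset.card_biUnion_le.trans ((Finset.sum_le_sum fun M hM =>
    (h𝓜 M hM).1.card_perm_extending_le).trans_eq ?_)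
  rw [← Finset.sum_fiberwise_of_maps_to' hmaps (fun l => (n - l).factorial)]
  simp

/-- `Match` on `n`-vertex (per side) graphs: `(1/2)·Pr_{c odd}[F_𝓜(x(c)) = 0] +
(1/2)·Pr_{P}[F_𝓜(P) = 1] ≤ 1/2 + Σ_{ℓ=1}^{n} (e·r/n)^ℓ` for any `r`-small monotone DNF
`F_𝓜` whose terms are nonempty matchings. -/
theorem small_dnf_bad_correlation (n : ℕ) (hn : 1 ≤ n) (r : ℝ) (hr : 0 ≤ r)
    (𝓜 : Finset (Finset (Fin n × Fin n)))
    (h𝓜 : ∀ M ∈ 𝓜, IsMatching M ∧ M.Nonempty)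
    (hsmall : ∀ ℓ : ℕ, 1 ≤ ℓ → ((𝓜.filter (fun M => M.card = ℓ)).card : ℝ) ≤ r ^ ℓ) :
    (1 / 2 : ℝ) *
        ((Nat.card {c : Fin n ⊕ Fin n → Bool // OddColouring c ∧
            ¬ ∃ M ∈ 𝓜, M ⊆ graphOf c} : ℝ) /
          (Nat.card {c : Fin n ⊕ Fin n → Bool // OddColouring c} : ℝ)) +
      (1 / 2 : ℝ) *
        ((Nat.card {P : Finset (Fin n × Fin n) // (IsMatching P ∧ P.card = n) ∧
            ∃ M ∈ 𝓜, M ⊆ P} : ℝ) /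
          (Nat.card {P : Finset (Fin n × Fin n) // IsMatching P ∧ P.card = n} : ℝ))
      ≤ 1 / 2 + ∑ ℓ ∈ Finset.Icc 1 n, (Real.exp 1 * r / (n : ℝ)) ^ ℓ := by
  have hodd : ((Nat.card {c : Fin n ⊕ Fin n → Bool // OddColouring c ∧
      ¬ ∃ M ∈ 𝓜, M ⊆ graphOf c} : ℝ) /
      (Nat.card {c : Fin n ⊕ Fin n → Bool // OddColouring c} : ℝ)) ≤ 1 := by
    refine div_le_one_of_le₀ ?_ (Nat.cast_nonneg _)
    exact_mod_cast Nat.card_le_card_of_injective _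
      (Subtype.map_injective (fun c (hc : OddColouring c ∧ ¬ ∃ M ∈ 𝓜, M ⊆ graphOf c) => hc.1)
        Function.injective_id)
  have hperfect : ((Nat.card {P : Finset (Fin n × Fin n) // (IsMatching P ∧ P.card = n) ∧
      ∃ M ∈ 𝓜, M ⊆ P} : ℝ) /
      (Nat.card {P : Finset (Fin n × Fin n) // IsMatching P ∧ P.card = n} : ℝ)) ≤
      ∑ ℓ ∈ Finset.Icc 1 n, (Real.exp 1 * r / (n : ℝ)) ^ ℓ := by
    rw [card_perfectMatching]
    calc _ ≤ (∑ l ∈ Finset.Icc 1 n, ((𝓜.filter (fun M => M.card = l)).card : ℝ) *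
          (n - l).factorial) / n.factorial := by
          gcongr
          exact_mod_cast card_perfectMatching_accepted_le 𝓜 h𝓜
      _ ≤ _ := by
          rw [Finset.sum_div]
          refine Finset.sum_le_sum fun l hl => ?_
          obtain ⟨hl1, hln⟩ := Finset.mem_Icc.1 hl
          rw [mul_div_assoc, mul_comm (Real.exp 1), mul_div_assoc, mul_pow]
          exact mul_le_mul (hsmall l hl1) (factorial_sub_div_factorial_le hn hln)
            (by positivity) (by positivity)
  have hnonneg : 0 ≤ ∑ ℓ ∈ Finset.Icc 1 n, (Real.exp 1 * r / (n : ℝ)) ^ ℓ :=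
    Finset.sum_nonneg fun _ _ => by positivity
  linarith
end

section
/- Let n, w ≥ 1, let ε ∈ (0,1), and let r ≥ 1 be a real number such that for every ℓ with 1 ≤ ℓ ≤ 2w, every family of ℓ-matchings in K_{n,n} of size greater than r^ℓ contains an ε-matching sunflower. Then for every finite family M of matchings in K_{n,n}, each of size at most 2w, there exists a finite family G of matchings, each of size at most 2w, such that: (i) for every ℓ with 1 ≤ ℓ ≤ 2w, the number of ℓ-matchings in G is at most r^ℓ; (ii) F_G(x) ≥ F_M(x) for every graph x; and (iii) the probability, over c sampled uniformly among colourings of L ⊕ R with an odd number of vertices coloured 1, that F_G(x(c)) = 1 while F_M(x(c)) = 0 is at most |M| · ε. -/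
/-- A family `M'` of `ℓ`-matchings with `|M'| ≥ 2` and core `K = ⋂ M'` is an `ε`-matching
sunflower if for `c` sampled uniformly among colourings of `L ⊕ R` with an odd number of
vertices coloured 1, the probability that some `M ∈ M'` has every edge of `M \ K`
monochromatic under `c` is at least `1 - ε`. -/
def IsMatchingSunflower (n : ℕ) (ε : ℝ) (𝓜' : Finset (Finset (Fin n × Fin n))) : Prop :=
  2 ≤ 𝓜'.card ∧
  1 - ε ≤
    (Nat.card {c : Fin n ⊕ Fin n → Bool // OddColouring c ∧
        ∃ M ∈ 𝓜', ∀ e ∈ M \ 𝓜'.inf id, c (Sum.inl e.1) = c (Sum.inr e.2)} : ℝ) /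
      (Nat.card {c : Fin n ⊕ Fin n → Bool // OddColouring c} : ℝ)

theorem card_subtype_le_add_of_imp_or {α : Type*} [Finite α] {p q s : α → Prop}
    (h : ∀ a, p a → q a ∨ s a) :
    Nat.card {a // p a} ≤ Nat.card {a // q a} + Nat.card {a // s a} :=
  (Set.ncard_le_ncard (s := {a | p a}) (t := {a | q a} ∪ {a | s a}) h).trans
    (Set.ncard_union_le _ _)

theorem card_subtype_add_le_of_disjoint {α : Type*} [Finite α] {p q s : α → Prop}
    (hp : ∀ a, p a → s a) (hq : ∀ a, q a → s a) (hpq : ∀ a, p a → ¬ q a) :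
    Nat.card {a // p a} + Nat.card {a // q a} ≤ Nat.card {a // s a} := by
  have hd : Disjoint {a | p a} {a | q a} := Set.disjoint_left.2 hpq
  exact (Set.ncard_union_eq hd).symm.le.trans
    (Set.ncard_le_ncard (t := {a | s a}) (Set.union_subset hp hq))

theorem mem_graphOf {n : ℕ} {c : Fin n ⊕ Fin n → Bool} {e : Fin n × Fin n} :
    e ∈ graphOf c ↔ c (Sum.inl e.1) = c (Sum.inr e.2) := by
  simp [graphOf]

theorem IsMatching.subset {n : ℕ} {M K : Finset (Fin n × Fin n)} (hM : IsMatching M)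
    (hK : K ⊆ M) : IsMatching K :=
  fun e he e' he' => hM e (hK he) e' (hK he')

/-- Few odd colourings contain the core of a sunflower but none of its members. -/
theorem IsMatchingSunflower.card_core_without_member_le {n : ℕ} {ε : ℝ}
    {𝓢 : Finset (Finset (Fin n × Fin n))} (h𝓢 : IsMatchingSunflower n ε 𝓢) (hε1 : ε < 1) :
    (Nat.card {c : Fin n ⊕ Fin n → Bool // OddColouring c ∧
        𝓢.inf id ⊆ graphOf c ∧ ¬ ∃ M ∈ 𝓢, M ⊆ graphOf c} : ℝ) ≤
      ε * (Nat.card {c : Fin n ⊕ Fin n → Bool // OddColouring c} : ℝ) := by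
  have hprob := h𝓢.2
  have hN : (0 : ℝ) < (Nat.card {c : Fin n ⊕ Fin n → Bool // OddColouring c} : ℝ) := by
    refine lt_of_le_of_ne (Nat.cast_nonneg _) fun h0 => ?_
    rw [← h0, div_zero] at hprob
    linarith
  rw [le_div_iff₀ hN] at hprob
  have hdisj : Nat.card {c : Fin n ⊕ Fin n → Bool // OddColouring c ∧
        𝓢.inf id ⊆ graphOf c ∧ ¬ ∃ M ∈ 𝓢, M ⊆ graphOf c} +
      Nat.card {c : Fin n ⊕ Fin n → Bool // OddColouring c ∧
        ∃ M ∈ 𝓢, ∀ e ∈ M \ 𝓢.inf id, c (Sum.inl e.1) = c (Sum.inr e.2)} ≤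
      Nat.card {c : Fin n ⊕ Fin n → Bool // OddColouring c} := by
    refine card_subtype_add_le_of_disjoint (fun _ h => h.1) (fun _ h => h.1) ?_
    rintro c ⟨-, hcore, hnone⟩ ⟨-, M, hM, hmono⟩
    refine hnone ⟨M, hM, fun e he => ?_⟩
    by_cases heK : e ∈ 𝓢.inf id
    · exact hcore heK
    · exact mem_graphOf.2 (hmono e (Finset.mem_sdiff.2 ⟨he, heK⟩))
  have hdisj' := (Nat.cast_le (α := ℝ)).2 hdisj
  push_cast at hdisj'
  linarith

/-- Replacing a subfamily with at least two members by a single set shrinks the family. -/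
theorem card_insert_sdiff_lt {α : Type*} [DecidableEq α] {s t : Finset α} (hts : t ⊆ s)
    (ht : 2 ≤ t.card) (a : α) : (insert a (s \ t)).card + 1 ≤ s.card := by
  have h₁ := Finset.card_insert_le a (s \ t)
  have h₂ := Finset.card_sdiff_add_card_eq_card hts
  omega

/-- Plucking, with the error measured by the number of colourings. -/
theorem exists_plucked_family {n w : ℕ} {ε : ℝ} (hε0 : 0 < ε) (hε1 : ε < 1) {r : ℝ}
    (hsun : ∀ ℓ : ℕ, 1 ≤ ℓ → ℓ ≤ 2 * w →
      ∀ 𝓕 : Finset (Finset (Fin n × Fin n)),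
        (∀ M ∈ 𝓕, IsMatching M ∧ M.card = ℓ) → r ^ ℓ < (𝓕.card : ℝ) →
        ∃ 𝓕' ⊆ 𝓕, IsMatchingSunflower n ε 𝓕')
    (𝓜 : Finset (Finset (Fin n × Fin n)))
    (h𝓜 : ∀ M ∈ 𝓜, IsMatching M ∧ M.card ≤ 2 * w) :
    ∃ 𝓖 : Finset (Finset (Fin n × Fin n)),
      (∀ M ∈ 𝓖, IsMatching M ∧ M.card ≤ 2 * w) ∧
      (∀ ℓ : ℕ, 1 ≤ ℓ → ℓ ≤ 2 * w →
        ((𝓖.filter (fun M => M.card = ℓ)).card : ℝ) ≤ r ^ ℓ) ∧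
      (∀ x : Finset (Fin n × Fin n), (∃ M ∈ 𝓜, M ⊆ x) → (∃ M ∈ 𝓖, M ⊆ x)) ∧
      (Nat.card {c : Fin n ⊕ Fin n → Bool // OddColouring c ∧
          (∃ M ∈ 𝓖, M ⊆ graphOf c) ∧ ¬ (∃ M ∈ 𝓜, M ⊆ graphOf c)} : ℝ)
        ≤ (𝓜.card : ℝ) * ε *
          (Nat.card {c : Fin n ⊕ Fin n → Bool // OddColouring c} : ℝ) := by
  induction hk : 𝓜.card using Nat.strong_induction_on generalizing 𝓜 with
  | _ k ih =>
  subst hk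
  by_cases hsmall : ∀ ℓ : ℕ, 1 ≤ ℓ → ℓ ≤ 2 * w →
      ((𝓜.filter (fun M => M.card = ℓ)).card : ℝ) ≤ r ^ ℓ
  · refine ⟨𝓜, h𝓜, hsmall, fun _ h => h, ?_⟩
    have : IsEmpty {c : Fin n ⊕ Fin n → Bool // OddColouring c ∧
        (∃ M ∈ 𝓜, M ⊆ graphOf c) ∧ ¬ (∃ M ∈ 𝓜, M ⊆ graphOf c)} :=
      ⟨fun c => c.2.2.2 c.2.2.1⟩
    rw [Nat.card_of_isEmpty]
    push_cast
    positivity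
  push Not at hsmall
  obtain ⟨ℓ, hℓ1, hℓw, hlarge⟩ := hsmall
  obtain ⟨𝓢, h𝓢sub, h𝓢⟩ := hsun ℓ hℓ1 hℓw _ (fun M hM =>
    ⟨(h𝓜 M (Finset.mem_filter.1 hM).1).1, (Finset.mem_filter.1 hM).2⟩) hlarge
  have h𝓢𝓜 : 𝓢 ⊆ 𝓜 := h𝓢sub.trans (Finset.filter_subset _ _)
  have hcore : ∀ M ∈ 𝓢, 𝓢.inf id ⊆ M := fun M hM => Finset.inf_le (f := id) hM
  have hcard := card_insert_sdiff_lt h𝓢𝓜 h𝓢.1 (𝓢.inf id)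
  obtain ⟨M₀, hM₀⟩ : 𝓢.Nonempty := Finset.card_pos.1 (by have := h𝓢.1; omega)
  obtain ⟨𝓖, h𝓖, h𝓖small, h𝓖acc, h𝓖err⟩ := ih _ hcard (insert (𝓢.inf id) (𝓜 \ 𝓢)) (by
    intro M hM
    rcases Finset.mem_insert.1 hM with rfl | hM
    · have h₀ := h𝓜 M₀ (h𝓢𝓜 hM₀)
      exact ⟨h₀.1.subset (hcore M₀ hM₀), (Finset.card_le_card (hcore M₀ hM₀)).trans h₀.2⟩
    · exact h𝓜 M (Finset.mem_sdiff.1 hM).1) rfl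
  refine ⟨𝓖, h𝓖, h𝓖small, fun x ⟨M, hM, hMx⟩ => h𝓖acc x ?_, ?_⟩
  · by_cases hM𝓢 : M ∈ 𝓢
    · exact ⟨_, Finset.mem_insert_self _ _, (hcore M hM𝓢).trans hMx⟩
    · exact ⟨M, Finset.mem_insert_of_mem (Finset.mem_sdiff.2 ⟨hM, hM𝓢⟩), hMx⟩
  have hsplit : Nat.card {c : Fin n ⊕ Fin n → Bool // OddColouring c ∧
        (∃ M ∈ 𝓖, M ⊆ graphOf c) ∧ ¬ (∃ M ∈ 𝓜, M ⊆ graphOf c)} ≤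
      Nat.card {c : Fin n ⊕ Fin n → Bool // OddColouring c ∧ (∃ M ∈ 𝓖, M ⊆ graphOf c) ∧
        ¬ (∃ M ∈ insert (𝓢.inf id) (𝓜 \ 𝓢), M ⊆ graphOf c)} +
      Nat.card {c : Fin n ⊕ Fin n → Bool // OddColouring c ∧
        𝓢.inf id ⊆ graphOf c ∧ ¬ ∃ M ∈ 𝓢, M ⊆ graphOf c} := by
    refine card_subtype_le_add_of_imp_or fun c ⟨hc, hG, hnone⟩ => ?_
    by_cases hK : 𝓢.inf id ⊆ graphOf c
    · exact Or.inr ⟨hc, hK, fun ⟨M, hM, hMc⟩ => hnone ⟨M, h𝓢𝓜 hM, hMc⟩⟩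
    · refine Or.inl ⟨hc, hG, fun ⟨M, hM, hMc⟩ => ?_⟩
      rcases Finset.mem_insert.1 hM with rfl | hM
      · exact hK hMc
      · exact hnone ⟨M, (Finset.mem_sdiff.1 hM).1, hMc⟩
  have hsplit' := (Nat.cast_le (α := ℝ)).2 hsplit
  have hcard' := (Nat.cast_le (α := ℝ)).2 hcard
  push_cast at hsplit' hcard'
  have hmul := mul_le_mul_of_nonneg_right hcard' (mul_nonneg hε0.le
    (Nat.cast_nonneg (α := ℝ) (Nat.card {c : Fin n ⊕ Fin n → Bool // OddColouring c})))
  have herr := h𝓢.card_core_without_member_le hε1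
  linarith

/-- Plucking: assuming the matching-sunflower property with parameters `(r, ε)` for every
width `1 ≤ ℓ ≤ 2w`, every family `𝓜` of matchings of size at most `2w` can be replaced by an
`r`-small family `𝓖` of matchings of size at most `2w` with `F_𝓖 ≥ F_𝓜` pointwise and
`Pr_{c odd}[F_𝓖(x(c)) = 1 ∧ F_𝓜(x(c)) = 0] ≤ |𝓜| · ε`. -/
theorem pluck_procedure (n w : ℕ) (hn : 1 ≤ n) (hw : 1 ≤ w)
    (ε : ℝ) (hε0 : 0 < ε) (hε1 : ε < 1) (r : ℝ) (hr : 1 ≤ r)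
    (hsun : ∀ ℓ : ℕ, 1 ≤ ℓ → ℓ ≤ 2 * w →
      ∀ 𝓕 : Finset (Finset (Fin n × Fin n)),
        (∀ M ∈ 𝓕, IsMatching M ∧ M.card = ℓ) → r ^ ℓ < (𝓕.card : ℝ) →
        ∃ 𝓕' ⊆ 𝓕, IsMatchingSunflower n ε 𝓕')
    (𝓜 : Finset (Finset (Fin n × Fin n)))
    (h𝓜 : ∀ M ∈ 𝓜, IsMatching M ∧ M.card ≤ 2 * w) :
    ∃ 𝓖 : Finset (Finset (Fin n × Fin n)),
      (∀ M ∈ 𝓖, IsMatching M ∧ M.card ≤ 2 * w) ∧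
      (∀ ℓ : ℕ, 1 ≤ ℓ → ℓ ≤ 2 * w →
        ((𝓖.filter (fun M => M.card = ℓ)).card : ℝ) ≤ r ^ ℓ) ∧
      (∀ x : Finset (Fin n × Fin n), (∃ M ∈ 𝓜, M ⊆ x) → (∃ M ∈ 𝓖, M ⊆ x)) ∧
      (Nat.card {c : Fin n ⊕ Fin n → Bool // OddColouring c ∧
          (∃ M ∈ 𝓖, M ⊆ graphOf c) ∧ ¬ (∃ M ∈ 𝓜, M ⊆ graphOf c)} : ℝ) /
          (Nat.card {c : Fin n ⊕ Fin n → Bool // OddColouring c} : ℝ)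
        ≤ (𝓜.card : ℝ) * ε := by
  obtain ⟨𝓖, h𝓖, hsmall, hacc, herr⟩ := exists_plucked_family hε0 hε1 hsun 𝓜 h𝓜
  exact ⟨𝓖, h𝓖, hsmall, hacc, div_le_of_le_mul₀ (Nat.cast_nonneg _)
    (mul_nonneg (Nat.cast_nonneg _) hε0.le) herr⟩
end

section
/- A finite simple graph G has a spanning subgraph in which every vertex of G has odd degree if and only if every connected component of G has an even number of vertices. -/
namespace SimpleGraph

variable {V : Type*} [Fintype V]

/-- The vertex labellings modulo 2 that arise as boundaries of edge labellings of `G`. -/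
def boundaries (G : SimpleGraph V) : AddSubmonoid (V → ZMod 2) where
  carrier := {x | ∃ f : V → V → ZMod 2, (∀ u v, f u v = f v u) ∧
    (∀ u v, f u v ≠ 0 → G.Adj u v) ∧ ∀ v, ∑ u, f v u = x v}
  zero_mem' := ⟨0, by simp⟩
  add_mem' := by
    rintro x y ⟨f, hf, hfG, hfx⟩ ⟨g, hg, hgG, hgy⟩
    refine ⟨f + g, fun u v ↦ by simp [hf u v, hg u v], fun u v h ↦ ?_, fun v ↦ by
      simp [Finset.sum_add_distrib, hfx, hgy]⟩
    by_contra hn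
    exact h (by simp [not_not.1 (mt (hfG u v) hn), not_not.1 (mt (hgG u v) hn)])

lemma single_add_single_mem_boundaries_of_adj [DecidableEq V] {G : SimpleGraph V} {a b : V}
    (h : G.Adj a b) : Pi.single a 1 + Pi.single b 1 ∈ G.boundaries := by
  refine ⟨fun u v ↦ if (u = a ∧ v = b) ∨ (u = b ∧ v = a) then 1 else 0, fun u v ↦ ?_,
    fun u v huv ↦ ?_, fun v ↦ ?_⟩
  · simp only [and_comm, or_comm]
  · have : (u = a ∧ v = b) ∨ (u = b ∧ v = a) := by
      by_contra hn
      simp [hn] at huv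
    rcases this with ⟨rfl, rfl⟩ | ⟨rfl, rfl⟩
    exacts [h, h.symm]
  · have hab := h.ne
    by_cases ha : v = a
    · subst ha
      simp [hab]
    · by_cases hb : v = b
      · subst hb
        simp [ha]
      · simp [ha, hb]

lemma Reachable.single_add_single_mem_boundaries [DecidableEq V] {G : SimpleGraph V} {a b : V}
    (h : G.Reachable a b) : Pi.single a 1 + Pi.single b 1 ∈ G.boundaries := by
  obtain ⟨p⟩ := h
  induction p with
  | nil =>
    rw [← Pi.single_add, CharTwo.add_self_eq_zero, Pi.single_zero]
    exact zero_mem _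
  | @cons u v w huv _ ih =>
    have := add_mem (single_add_single_mem_boundaries_of_adj huv) ih
    rwa [add_assoc, ← add_assoc (Pi.single v 1), ← Pi.single_add, CharTwo.add_self_eq_zero,
      Pi.single_zero, zero_add] at this

lemma one_mem_boundaries {G : SimpleGraph V}
    (h : ∀ C : G.ConnectedComponent, Even (Nat.card C.supp)) : 1 ∈ G.boundaries := by
  classical
  let r : V → V := fun v ↦ (G.connectedComponentMk v).out
  have hr (v : V) : G.connectedComponentMk (r v) = G.connectedComponentMk v := Quot.out_eq _
  have key : (1 : V → ZMod 2) = ∑ v, (Pi.single v 1 + Pi.single (r v) 1) := by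
    ext w
    have hw : (Finset.univ.filter fun v ↦ w = r v).card = (0 : ZMod 2) := by
      rw [ZMod.natCast_eq_zero_iff_even]
      by_cases hrw : r w = w
      · convert h (G.connectedComponentMk w) using 1
        rw [Nat.card_eq_fintype_card, ← Set.toFinset_card]
        congr 1
        ext v
        simp only [Finset.mem_filter, Finset.mem_univ, true_and, Set.mem_toFinset,
          ConnectedComponent.mem_supp_iff]
        constructor
        · rintro rfl
          exact (hr v).symm
        · intro hv
          rw [← hrw]
          simp only [r, hv]
      · rw [Finset.filter_eq_empty_iff.2]
        · simp
        · rintro v - rfl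
          exact hrw (congrArg Quot.out (hr v))
    simp [Finset.sum_add_distrib, Pi.single_apply, hw]
  rw [key]
  exact sum_mem fun v _ ↦ (ConnectedComponent.exact (hr v)).symm.single_add_single_mem_boundaries

lemma natCast_card_adj (H : SimpleGraph V) [DecidableRel H.Adj] (v : V) :
    ((Nat.card {u : V // H.Adj v u} : ℕ) : ZMod 2) = ∑ u, if H.Adj v u then 1 else 0 := by
  simp [Fintype.card_subtype]

lemma even_card_supp_of_odd_degrees {G H : SimpleGraph V} (hHG : H ≤ G)
    (hH : ∀ v : V, Odd (Nat.card {u : V // H.Adj v u})) (C : G.ConnectedComponent) :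
    Even (Nat.card C.supp) := by
  classical
  have hsum (v : V) (hv : v ∈ C.supp.toFinset) :
      ∑ u ∈ C.supp.toFinset, (if H.Adj v u then 1 else 0 : ZMod 2) = 1 := by
    have hodd := ZMod.natCast_eq_one_iff_odd.2 (hH v)
    rw [natCast_card_adj] at hodd
    refine Eq.trans ?_ hodd
    exact Finset.sum_subset (Finset.subset_univ _) fun u _ hu ↦ if_neg fun huv ↦ hu <| by
      rw [Set.mem_toFinset, ConnectedComponent.mem_supp_iff] at hv ⊢
      rw [← hv, ConnectedComponent.eq]
      exact (hHG huv).reachable.symm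
  rw [← ZMod.natCast_eq_zero_iff_even, Nat.card_eq_fintype_card, ← Set.toFinset_card,
    Finset.card_eq_sum_ones, Nat.cast_sum, Nat.cast_one, ← Finset.sum_congr rfl hsum,
    ← Finset.sum_product']
  refine Finset.sum_involution (fun p _ ↦ p.swap) ?_ ?_ ?_ ?_
  · intro p _
    simp [H.adj_comm p.2 p.1, CharTwo.add_self_eq_zero]
  · rintro ⟨u, v⟩ _ h heq
    obtain rfl : v = u := congrArg Prod.fst heq
    simp at h
  · simp +contextual
  · simp

lemma exists_odd_degrees_of_one_mem_boundaries {G : SimpleGraph V} (h : 1 ∈ G.boundaries) :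
    ∃ H : SimpleGraph V, H ≤ G ∧ ∀ v : V, Odd (Nat.card {u : V // H.Adj v u}) := by
  classical
  obtain ⟨f, hf, hfG, hf1⟩ := h
  refine ⟨⟨fun u v ↦ f u v ≠ 0, ⟨fun u v h ↦ hf u v ▸ h⟩, ⟨fun u h ↦ (hfG u u h).ne rfl⟩⟩,
    fun u v h ↦ hfG u v h, fun v ↦ ?_⟩
  rw [← ZMod.natCast_eq_one_iff_odd, natCast_card_adj]
  refine Eq.trans (Finset.sum_congr rfl fun u _ ↦ ?_) (hf1 v)
  have key : ∀ x : ZMod 2, (if x ≠ 0 then 1 else 0) = x := by decide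
  convert key (f v u)

end SimpleGraph

/-- A finite simple graph `G` has a spanning subgraph (a subgraph `H ≤ G` on the same vertex
set) in which every vertex has odd degree iff every connected component of `G` has an even
number of vertices. -/
theorem odd_factor_iff_even_components {V : Type*} [Fintype V] (G : SimpleGraph V) :
    (∃ H : SimpleGraph V, H ≤ G ∧ ∀ v : V, Odd (Nat.card {u : V // H.Adj v u})) ↔
      ∀ C : G.ConnectedComponent, Even (Nat.card C.supp) :=
  ⟨fun ⟨_, hHG, hH⟩ ↦ SimpleGraph.even_card_supp_of_odd_degrees hHG hH, fun h ↦
    SimpleGraph.exists_odd_degrees_of_one_mem_boundaries (SimpleGraph.one_mem_boundaries h)⟩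
end
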